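/- arXiv:2405.17946 — 10 statements merged into one kernel-verified Lean document; each statement's English description precedes it below -/
import Mathlib

section
/- Let B be a bit channel with Shannon capacity C(B). For every classical strategy using a single use of B assisted by arbitrary shared randomness, with induced conditional distribution p(y|b,x), the worst-case probability of opening the box containing the bomb satisfies max over pairs (b,x) with x ≠ b of p(b|b,x) ≥ (1 − C(B))^{ln 4} / 16, where ln 4 is the natural logarithm of 4. -/
/-- Binary entropy (base 2), with the convention `0 * log 0 = 0`
(automatic since `Real.logb 2 0 = 0`). -/
noncomputable def H2 (t : ℝ) : ℝ :=
  -(t * Real.logb 2 t) - (1 - t) * Real.logb 2 (1 - t)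

/-- Mutual information of a bit channel with `p = p_B(0|1)`, `q = p_B(1|0)`
and input prior `(s, 1 - s)`. -/
noncomputable def mutualInfo (p q s : ℝ) : ℝ :=
  H2 (s * q + (1 - s) * (1 - p)) - s * H2 q - (1 - s) * H2 p

/-- Shannon capacity of a bit channel with `p = p_B(0|1)`, `q = p_B(1|0)`. -/
noncomputable def capacity (p q : ℝ) : ℝ :=
  sSup {x | ∃ s ∈ Set.Icc (0 : ℝ) 1, x = mutualInfo p q s}

/-- `H2` is the natural-log binary entropy, rescaled. -/
lemma H2_eq_binEntropy_div (t : ℝ) : H2 t = Real.binEntropy t / Real.log 2 := by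
  simp only [H2, Real.binEntropy, Real.logb, Real.log_inv]
  ring

lemma H2_nonneg {t : ℝ} (h0 : 0 ≤ t) (h1 : t ≤ 1) : 0 ≤ H2 t := by
  rw [H2_eq_binEntropy_div]
  exact div_nonneg (Real.binEntropy_nonneg h0 h1) (Real.log_nonneg one_le_two)

lemma H2_le_one (t : ℝ) : H2 t ≤ 1 := by
  rw [H2_eq_binEntropy_div, div_le_one (Real.log_pos one_lt_two)]
  exact Real.binEntropy_le_log_two

lemma H2_one_sub (t : ℝ) : H2 (1 - t) = H2 t := by
  simp [H2_eq_binEntropy_div]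

section Capacity

variable {p q : ℝ}

lemma mutualInfo_le_one (hp0 : 0 ≤ p) (hp1 : p ≤ 1) (hq0 : 0 ≤ q) (hq1 : q ≤ 1)
    {s : ℝ} (hs : s ∈ Set.Icc (0 : ℝ) 1) : mutualInfo p q s ≤ 1 := by
  have hq := mul_nonneg hs.1 (H2_nonneg hq0 hq1)
  have hp := mul_nonneg (sub_nonneg.2 hs.2) (H2_nonneg hp0 hp1)
  have := H2_le_one (s * q + (1 - s) * (1 - p))
  unfold mutualInfo
  linarith

lemma capacity_le_one (hp0 : 0 ≤ p) (hp1 : p ≤ 1) (hq0 : 0 ≤ q) (hq1 : q ≤ 1) :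
    capacity p q ≤ 1 := by
  refine csSup_le ⟨_, 0, by simp, rfl⟩ ?_
  rintro _ ⟨s, hs, rfl⟩
  exact mutualInfo_le_one hp0 hp1 hq0 hq1 hs

lemma mutualInfo_le_capacity (hp0 : 0 ≤ p) (hp1 : p ≤ 1) (hq0 : 0 ≤ q) (hq1 : q ≤ 1)
    {s : ℝ} (hs : s ∈ Set.Icc (0 : ℝ) 1) : mutualInfo p q s ≤ capacity p q := by
  refine le_csSup ⟨1, ?_⟩ ⟨s, hs, rfl⟩
  rintro _ ⟨r, hr, rfl⟩
  exact mutualInfo_le_one hp0 hp1 hq0 hq1 hr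

/-- Flipping the output bit does not change the capacity. -/
lemma capacity_one_sub (p q : ℝ) : capacity (1 - p) (1 - q) = capacity p q := by
  have h (s : ℝ) : mutualInfo (1 - p) (1 - q) s = mutualInfo p q s := by
    unfold mutualInfo
    rw [H2_one_sub, H2_one_sub, ← H2_one_sub (s * q + (1 - s) * (1 - p))]
    ring_nf
  simp only [capacity, h]

lemma mul_log_sub_mul_log_le {a A t : ℝ} (ha : 0 ≤ a) (hA : a ≤ A) (ht : 0 < t) :
    a * Real.log A - a * Real.log a ≤ -(a * Real.log t) + A * t - a := by
  rcases ha.eq_or_lt with rfl | ha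
  · simp only [zero_mul, sub_zero, neg_zero, zero_add]
    positivity
  have hA' : 0 < A := ha.trans_le hA
  have h := Real.log_le_sub_one_of_pos (show 0 < A * t / a by positivity)
  rw [Real.log_div (by positivity) ha.ne', Real.log_mul hA'.ne' ht.ne'] at h
  have h' := mul_le_mul_of_nonneg_left h ha.le
  have : a * (A * t / a - 1) = A * t - a := by field_simp
  linarith

/-- Fano's inequality for the uniform prior: the equivocation of a bit channel is at most the
binary entropy of its average error probability. -/
lemma one_sub_mutualInfo_half_le (hp0 : 0 ≤ p) (hq0 : 0 ≤ q) (hpq : p + q ≤ 1) :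
    1 - mutualInfo p q (1 / 2) ≤ H2 ((p + q) / 2) := by
  have h2 : 0 < Real.log 2 := Real.log_pos one_lt_two
  rcases (add_nonneg hp0 hq0).eq_or_lt with h | hd
  · obtain rfl : p = 0 := by linarith
    obtain rfl : q = 0 := by linarith
    have : Real.binEntropy (1 / 2) = Real.log 2 := by
      rw [one_div, Real.binEntropy_two_inv]
    norm_num [mutualInfo, H2_eq_binEntropy_div, this, h2.ne']
  set t := (p + q) / 2 with ht
  have ht0 : 0 < t := by positivity
  have ht1 : 0 < 1 - t := by linarith
  have e1 := mul_log_sub_mul_log_le hp0 (by linarith : p ≤ 1 - q + p) ht0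
  have e2 := mul_log_sub_mul_log_le (by linarith : 0 ≤ 1 - q)
    (by linarith : 1 - q ≤ 1 - q + p) ht1
  have e3 := mul_log_sub_mul_log_le hq0 (by linarith : q ≤ 1 + q - p) ht0
  have e4 := mul_log_sub_mul_log_le (by linarith : 0 ≤ 1 - p)
    (by linarith : 1 - p ≤ 1 + q - p) ht1
  have halve (x : ℝ) : x / 2 * Real.log (x / 2) = x / 2 * (Real.log x - Real.log 2) := by
    rcases eq_or_ne x 0 with rfl | hx
    · simp
    · rw [Real.log_div hx two_ne_zero]
  have l1 := halve (1 + q - p)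
  have l2 := halve (1 - q + p)
  have a1 : 1 / 2 * q + (1 - 1 / 2) * (1 - p) = (1 + q - p) / 2 := by ring
  have a2 : 1 - (1 + q - p) / 2 = (1 - q + p) / 2 := by ring
  have key : Real.log 2 - (Real.binEntropy ((1 + q - p) / 2) - 1 / 2 * Real.binEntropy q
      - (1 - 1 / 2) * Real.binEntropy p) ≤ Real.binEntropy t := by
    simp only [Real.binEntropy, Real.log_inv, a2]
    have ht' : t * 2 = p + q := by rw [ht]; ring
    have b1 : t * Real.log t * 2 = p * Real.log t + q * Real.log t := by
      linear_combination Real.log t * ht'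
    have b2 : (1 - t) * Real.log (1 - t) * 2
        = (1 - p) * Real.log (1 - t) + (1 - q) * Real.log (1 - t) := by
      linear_combination -Real.log (1 - t) * ht'
    linarith
  simp only [mutualInfo, a1, H2_eq_binEntropy_div]
  rw [le_div_iff₀ h2]
  refine le_trans (le_of_eq ?_) key
  field_simp

end Capacity

lemma H2_le_cube {z : ℝ} (hz0 : 0 < z) (hz1 : z ≤ 1) : H2 (z ^ 4 / 8) ≤ z ^ 3 := by
  have h2 : 0 < Real.log 2 := Real.log_pos one_lt_two
  have hz4 : z ^ 4 ≤ 1 := pow_le_one₀ hz0.le hz1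
  have hl := Real.log_le_sub_one_of_pos (inv_pos.2 hz0)
  rw [Real.log_inv] at hl
  have hlog : Real.log (z ^ 4 / 8) = 4 * Real.log z - 3 * Real.log 2 := by
    rw [Real.log_div (by positivity) (by norm_num), Real.log_pow,
      show (8 : ℝ) = 2 ^ 3 by norm_num, Real.log_pow]
    norm_num
  have hc := Real.one_sub_inv_le_log_of_pos (show 0 < 1 - z ^ 4 / 8 by linarith)
  have hc' : -((1 - z ^ 4 / 8) * Real.log (1 - z ^ 4 / 8)) ≤ z ^ 4 / 8 := by
    have hpos : 0 < 1 - z ^ 4 / 8 := by linarith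
    have := mul_le_mul_of_nonneg_left hc hpos.le
    rw [mul_sub, mul_inv_cancel₀ hpos.ne'] at this
    linarith
  rw [H2_eq_binEntropy_div, div_le_iff₀ h2, Real.binEntropy]
  simp only [Real.log_inv, hlog]
  have hm := mul_le_mul_of_nonneg_left hl (show 0 ≤ z ^ 4 / 2 by positivity)
  have hzi : z ^ 4 / 2 * (z⁻¹ - 1) = z ^ 3 / 2 - z ^ 4 / 2 := by field_simp
  have hlo := Real.log_two_gt_d9
  have hhi := Real.log_two_lt_d9
  have h3 : 0 < z ^ 3 := by positivity
  have h34 : z ^ 3 * (1 / 2) ≤ z ^ 3 * Real.log 2 := by gcongr; linarith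
  have h44 : z ^ 4 * Real.log 2 ≤ z ^ 4 * 1 := by gcongr; linarith
  linarith

lemma H2_rpow_log_four_le {t : ℝ} (ht0 : 0 ≤ t) (ht1 : t ≤ 1) :
    H2 t ^ Real.log 4 ≤ 8 * t := by
  have hlog : 4 / 3 ≤ Real.log 4 := by
    rw [show (4 : ℝ) = 2 ^ 2 by norm_num, Real.log_pow]
    have := Real.log_two_gt_d9
    push_cast
    linarith
  have hH := H2_nonneg ht0 ht1
  rcases ht0.eq_or_lt with rfl | ht
  · simp [H2, Real.zero_rpow (by linarith : Real.log 4 ≠ 0)]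
  rcases le_total 1 (8 * t) with h | h
  · exact (Real.rpow_le_one hH (H2_le_one t) (by linarith)).trans h
  set z := (8 * t) ^ (1 / 4 : ℝ) with hz
  have hz0 : 0 < z := by positivity
  have hz1 : z ≤ 1 := Real.rpow_le_one (by positivity) h (by norm_num)
  have hz4 : z ^ 4 = 8 * t := by
    rw [hz, ← Real.rpow_natCast, ← Real.rpow_mul (by positivity)]
    norm_num
  have hle : H2 t ≤ z ^ 3 := by
    have := H2_le_cube hz0 hz1
    rwa [hz4, mul_div_cancel_left₀ _ (by norm_num : (8 : ℝ) ≠ 0)] at this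
  calc H2 t ^ Real.log 4 ≤ (z ^ 3) ^ Real.log 4 := by gcongr
    _ ≤ (z ^ 3) ^ (4 / 3 : ℝ) :=
        Real.rpow_le_rpow_of_exponent_ge (by positivity) (pow_le_one₀ hz0.le hz1) hlog
    _ = z ^ 4 := by
        rw [← Real.rpow_natCast, ← Real.rpow_mul hz0.le, ← Real.rpow_natCast]
        norm_num
    _ = 8 * t := hz4

lemma one_sub_capacity_rpow_le {p q : ℝ} (hp0 : 0 ≤ p) (hq0 : 0 ≤ q) (hpq : p + q ≤ 1) :
    (1 - capacity p q) ^ Real.log 4 ≤ 4 * (p + q) := by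
  have hp1 : p ≤ 1 := by linarith
  have hq1 : q ≤ 1 := by linarith
  have hC := mutualInfo_le_capacity hp0 hp1 hq0 hq1 (s := 1 / 2) (by norm_num)
  have hF := one_sub_mutualInfo_half_le hp0 hq0 hpq
  calc (1 - capacity p q) ^ Real.log 4 ≤ H2 ((p + q) / 2) ^ Real.log 4 :=
        Real.rpow_le_rpow (sub_nonneg.2 (capacity_le_one hp0 hp1 hq0 hq1)) (by linarith)
          (Real.log_nonneg (by norm_num))
    _ ≤ 8 * ((p + q) / 2) := H2_rpow_log_four_le (by linarith) (by linarith)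
    _ = 4 * (p + q) := by ring

/-- If both rows of the channel dominate the sub-distribution `α`, then no strategy can push the
total bomb probability, over the four bomb positions, below the mass of `α`. -/
lemma sum_le_sum_bomb {ι : Type*} [Fintype ι] {pB : Fin 2 → Fin 2 → ℝ} {α : Fin 2 → ℝ}
    (hα : ∀ m' m, α m' ≤ pB m' m)
    {lam : ι → ℝ} (hlamnn : ∀ i, 0 ≤ lam i) (hlamsum : ∑ i, lam i = 1)
    {enc : ι → Fin 4 → Fin 2 → ℝ} (hencnn : ∀ i b m, 0 ≤ enc i b m)
    (hencsum : ∀ i b, ∑ m, enc i b m = 1)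
    {pdec : ι → Fin 2 → Fin 4 → ℝ} (hdecnn : ∀ i m' y, 0 ≤ pdec i m' y)
    (hdecsum : ∀ i m', ∑ y, pdec i m' y = 1) :
    ∑ m', α m' ≤ ∑ b, ∑ i, lam i * ∑ m, ∑ m', pdec i m' b * pB m' m * enc i b m := by
  have hb (i b) : ∑ m', α m' * pdec i m' b
      ≤ ∑ m, ∑ m', pdec i m' b * pB m' m * enc i b m := by
    calc ∑ m', α m' * pdec i m' b
        = ∑ m, ∑ m', pdec i m' b * α m' * enc i b m := by
          rw [Finset.sum_comm]
          simp_rw [← Finset.mul_sum, hencsum, mul_one, mul_comm]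
      _ ≤ _ := by
          gcongr with m _ m' _
          · exact hencnn i b m
          · exact hdecnn i m' b
          · exact hα m' m
  calc ∑ m', α m' = ∑ b, ∑ i, lam i * ∑ m', α m' * pdec i m' b := by
        rw [Finset.sum_comm]
        simp_rw [← Finset.mul_sum]
        have hi (i) : ∑ b, ∑ m', α m' * pdec i m' b = ∑ m', α m' := by
          rw [Finset.sum_comm]
          simp_rw [← Finset.mul_sum, hdecsum, mul_one]
        simp_rw [hi, ← Finset.sum_mul, hlamsum, one_mul]
    _ ≤ _ := Finset.sum_le_sum fun b _ => Finset.sum_le_sum fun i _ =>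
        mul_le_mul_of_nonneg_left (hb i b) (hlamnn i)

/-- For every classical strategy using a single use of a bit channel `B`
assisted by arbitrary shared randomness, the worst-case probability of opening the box
containing the bomb is at least `(1 - C(B))^(ln 4) / 16`. -/
theorem bomb_worst_case_capacity_bound
    (pB : Fin 2 → Fin 2 → ℝ)
    (hBnn : ∀ m' m, 0 ≤ pB m' m)
    (hBsum : ∀ m, ∑ m', pB m' m = 1)
    (n : ℕ) (lam : Fin n → ℝ)
    (hlamnn : ∀ i, 0 ≤ lam i) (hlamsum : ∑ i, lam i = 1)
    (penc : Fin n → Fin 4 → Fin 4 → Fin 2 → ℝ)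
    (hencnn : ∀ i b x m, x ≠ b → 0 ≤ penc i b x m)
    (hencsum : ∀ i b x, x ≠ b → ∑ m, penc i b x m = 1)
    (pdec : Fin n → Fin 2 → Fin 4 → ℝ)
    (hdecnn : ∀ i m' y, 0 ≤ pdec i m' y)
    (hdecsum : ∀ i m', ∑ y, pdec i m' y = 1)
    (p : Fin 4 → Fin 4 → Fin 4 → ℝ)
    (hp : ∀ y b x, x ≠ b →
      p y b x = ∑ i, lam i * ∑ m, ∑ m', pdec i m' y * pB m' m * penc i b x m) :
    ∃ b x, x ≠ b ∧
      (1 - capacity (pB 0 1) (pB 1 0)) ^ Real.log 4 / 16 ≤ p b b x := by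
  have hne (b : Fin 4) : b + 1 ≠ b := by simp
  have h0 := hBsum 0
  have h1 := hBsum 1
  rw [Fin.sum_univ_two] at h0 h1
  obtain ⟨α, hα, hcap⟩ : ∃ α : Fin 2 → ℝ, (∀ m' m, α m' ≤ pB m' m) ∧
      (1 - capacity (pB 0 1) (pB 1 0)) ^ Real.log 4 ≤ 4 * ∑ m', α m' := by
    rcases le_total (pB 0 1 + pB 1 0) 1 with h | h
    · refine ⟨![pB 0 1, pB 1 0], ?_, ?_⟩
      · simp only [Fin.forall_fin_two, Matrix.cons_val_zero, Matrix.cons_val_one]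
        refine ⟨⟨?_, ?_⟩, ?_, ?_⟩ <;> linarith
      · simpa using one_sub_capacity_rpow_le (hBnn 0 1) (hBnn 1 0) h
    · refine ⟨![pB 0 0, pB 1 1], ?_, ?_⟩
      · simp only [Fin.forall_fin_two, Matrix.cons_val_zero, Matrix.cons_val_one]
        refine ⟨⟨?_, ?_⟩, ?_, ?_⟩ <;> linarith
      · rw [← capacity_one_sub, show 1 - pB 0 1 = pB 1 1 by linarith,
          show 1 - pB 1 0 = pB 0 0 by linarith]
        simpa [add_comm] using
          one_sub_capacity_rpow_le (hBnn 1 1) (hBnn 0 0) (by linarith)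
  have hsum := sum_le_sum_bomb hα hlamnn hlamsum
    (enc := fun i b m => penc i b (b + 1) m) (fun i b m => hencnn i b _ m (hne b))
    (fun i b => hencsum i b _ (hne b)) hdecnn hdecsum
  simp_rw [← fun b => hp b b (b + 1) (hne b)] at hsum
  obtain ⟨b, -, hb⟩ := Finset.exists_le_of_sum_le (s := Finset.univ)
    (f := fun _ : Fin 4 => (1 - capacity (pB 0 1) (pB 1 0)) ^ Real.log 4 / 16)
    (g := fun b => p b b (b + 1)) Finset.univ_nonempty (by
      refine le_trans ?_ hsum
      simp only [Finset.sum_const, Finset.card_univ, Fintype.card_fin, nsmul_eq_mul]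
      push_cast
      linarith)
  exact ⟨b, b + 1, hne b, hb⟩
end

section
/- Let d ≤ 3 and consider a classical strategy without shared randomness that transmits a message m ∈ {1,…,d} through a noiseless channel: an encoding p_enc(m|b,x) (for each pair (b,x) with x ≠ b, a probability distribution over m ∈ {1,…,d}) and a decoding p_dec(y|m) (for each m, a probability distribution over y ∈ {1,2,3,4}), with induced distribution p(y|b,x) = Σ_{m} p_dec(y|m) p_enc(m|b,x). If the bomb is avoided with certainty, i.e. p(b|b,x) = 0 for every b and every x ≠ b, then there exist b and x ≠ b with p(x|b,x) = 0; in particular the worst-case winning probability min over (b,x) with x ≠ b of p(x|b,x) equals 0. -/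
/-- **Sperner's theorem** for indexed families: if no member of a finite family of finsets is
contained in another, the size of the family is at most the middle binomial coefficient. -/
theorem card_le_choose_of_pairwise_not_subset {ι α : Type*} [Fintype ι] [Fintype α]
    (T : ι → Finset α) (hT : ∀ i j, i ≠ j → ¬ T i ⊆ T j) :
    Fintype.card ι ≤ (Fintype.card α).choose (Fintype.card α / 2) := by
  classical
  have hinj : Function.Injective T := fun i j hij => by
    by_contra hne
    exact hT i j hne hij.subset
  have hanti : IsAntichain (· ⊆ ·)
      ((Finset.univ.image T : Finset (Finset α)) : Set (Finset α)) := by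
    intro s hs t ht hst
    simp only [Finset.coe_image, Finset.coe_univ, Set.image_univ, Set.mem_range] at hs ht
    obtain ⟨i, rfl⟩ := hs
    obtain ⟨j, rfl⟩ := ht
    exact hT i j fun hij => hst (congrArg T hij)
  have := hanti.sperner
  rwa [Finset.card_image_of_injective _ hinj, Finset.card_univ] at this

/-- With a noiseless `d`-dimensional classical channel, `d ≤ 3`, and no
shared randomness, every strategy that avoids the bomb with certainty has some
configuration `(b, x)` (with `x ≠ b`) in which the prize is found with probability zero;
in particular the worst-case winning probability is zero. -/
theorem no_shared_randomness_worst_case_zero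
    (d : ℕ) (hd : d ≤ 3)
    (penc : Fin 4 → Fin 4 → Fin d → ℝ)
    (hencnn : ∀ b x m, x ≠ b → 0 ≤ penc b x m)
    (hencsum : ∀ b x, x ≠ b → ∑ m, penc b x m = 1)
    (pdec : Fin d → Fin 4 → ℝ)
    (hdecnn : ∀ m y, 0 ≤ pdec m y)
    (hdecsum : ∀ m, ∑ y, pdec m y = 1)
    (p : Fin 4 → Fin 4 → Fin 4 → ℝ)
    (hp : ∀ y b x, x ≠ b → p y b x = ∑ m, pdec m y * penc b x m)
    (havoid : ∀ b x, x ≠ b → p b b x = 0) :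
    ∃ b x, x ≠ b ∧ p x b x = 0 := by
  classical
  by_contra! hwin
  have separates (b x : Fin 4) (hxb : x ≠ b) : ∃ m, pdec m x ≠ 0 ∧ pdec m b = 0 := by
    have hx := hwin b x hxb
    rw [hp x b x hxb] at hx
    obtain ⟨m, -, hm⟩ := Finset.exists_ne_zero_of_sum_ne_zero hx
    have hb := havoid b x hxb
    rw [hp b b x hxb, Finset.sum_eq_zero_iff_of_nonneg
      fun m _ => mul_nonneg (hdecnn m b) (hencnn b x m hxb)] at hb
    exact ⟨m, left_ne_zero_of_mul hm,
      (mul_eq_zero.mp (hb m (Finset.mem_univ m))).resolve_right (right_ne_zero_of_mul hm)⟩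
  have hd_le := card_le_choose_of_pairwise_not_subset
    (fun x => Finset.univ.filter fun m => pdec m x ≠ 0)
    fun x b hxb => by
      obtain ⟨m, hmx, hmb⟩ := separates b x hxb
      exact fun hsub => by simpa [hmb] using hsub (show m ∈ _ by simpa using hmx)
  interval_cases d <;> simp at hd_le
end

section
/- Let B be a bit channel and define its ambiguous probability p_?(B) = max_{m'∈{0,1}} min_{m∈{0,1}} p_B(m'|m). For every classical strategy using B assisted by shared randomness, with induced conditional distribution p(y|b,x), one has max over pairs (b,x) with x ≠ b of p(b|b,x) ≥ p_?(B)/4. -/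
/-- For every classical strategy using a bit channel `B` assisted by
shared randomness, the worst-case probability of opening the box with the bomb is at
least `p_?(B) / 4`, where `p_?(B) = max_{m'} min_{m} p_B(m'|m)` is the ambiguous
probability of `B`. -/
theorem bomb_worst_case_ambiguous_bound
    (pB : Fin 2 → Fin 2 → ℝ)
    (hBnn : ∀ m' m, 0 ≤ pB m' m)
    (hBsum : ∀ m, ∑ m', pB m' m = 1)
    (n : ℕ) (lam : Fin n → ℝ)
    (hlamnn : ∀ i, 0 ≤ lam i) (hlamsum : ∑ i, lam i = 1)
    (penc : Fin n → Fin 4 → Fin 4 → Fin 2 → ℝ)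
    (hencnn : ∀ i b x m, x ≠ b → 0 ≤ penc i b x m)
    (hencsum : ∀ i b x, x ≠ b → ∑ m, penc i b x m = 1)
    (pdec : Fin n → Fin 2 → Fin 4 → ℝ)
    (hdecnn : ∀ i m' y, 0 ≤ pdec i m' y)
    (hdecsum : ∀ i m', ∑ y, pdec i m' y = 1)
    (p : Fin 4 → Fin 4 → Fin 4 → ℝ)
    (hp : ∀ y b x, x ≠ b →
      p y b x = ∑ i, lam i * ∑ m, ∑ m', pdec i m' y * pB m' m * penc i b x m) :
    ∃ b x, x ≠ b ∧
      max (min (pB 0 0) (pB 0 1)) (min (pB 1 0) (pB 1 1)) / 4 ≤ p b b x := by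
  have key : ∀ k q, (∀ m, q ≤ pB k m) → ∃ b x, x ≠ b ∧ q / 4 ≤ p b b x := by
    intro k q hq
    have hne : ∀ b : Fin 4, b + 1 ≠ b := by decide
    have hlow : ∀ b, ∑ i, lam i * (pdec i k b * q) ≤ p b b (b + 1) := by
      intro b
      rw [hp b b (b + 1) (hne b)]
      refine Finset.sum_le_sum fun i _ => mul_le_mul_of_nonneg_left ?_ (hlamnn i)
      calc pdec i k b * q = ∑ m, pdec i k b * q * penc i b (b + 1) m := by
            rw [← Finset.mul_sum, hencsum i b (b + 1) (hne b), mul_one]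
        _ ≤ ∑ m, ∑ m', pdec i m' b * pB m' m * penc i b (b + 1) m := by
            refine Finset.sum_le_sum fun m _ => ?_
            have henc := hencnn i b (b + 1) m (hne b)
            calc pdec i k b * q * penc i b (b + 1) m
                ≤ pdec i k b * pB k m * penc i b (b + 1) m :=
                  mul_le_mul_of_nonneg_right
                    (mul_le_mul_of_nonneg_left (hq m) (hdecnn i k b)) henc
              _ ≤ _ := Finset.single_le_sum
                  (f := fun m' => pdec i m' b * pB m' m * penc i b (b + 1) m)
                  (fun m' _ => mul_nonneg (mul_nonneg (hdecnn i m' b) (hBnn m' m)) henc)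
                  (Finset.mem_univ k)
    have htotal : ∑ b, ∑ i, lam i * (pdec i k b * q) = q := by
      rw [Finset.sum_comm]
      simp only [← Finset.mul_sum, ← Finset.sum_mul, hdecsum, hlamsum, one_mul]
    have hsum : ∑ _b : Fin 4, q / 4 ≤ ∑ b, p b b (b + 1) := by
      calc ∑ _b : Fin 4, q / 4 = q := by simp; ring
        _ ≤ _ := htotal ▸ Finset.sum_le_sum fun b _ => hlow b
    obtain ⟨b, -, hb⟩ := Finset.exists_le_of_sum_le Finset.univ_nonempty hsum
    exact ⟨b, b + 1, hne b, hb⟩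
  have hmin : ∀ k m, min (pB k 0) (pB k 1) ≤ pB k m := by
    intro k m
    fin_cases m
    · exact min_le_left _ _
    · exact min_le_right _ _
  rcases max_choice (min (pB 0 0) (pB 0 1)) (min (pB 1 0) (pB 1 1)) with h | h <;> rw [h]
  · exact key 0 _ (hmin 0)
  · exact key 1 _ (hmin 1)
end

section
/- For every bit channel B, with p := p_B(0|1) and q := p_B(1|0), the Shannon capacity satisfies C(B) ≥ 1 − H₂((p+q)/2); i.e., the capacity of B is at least the capacity of the binary symmetric channel obtained by symmetrizing B. -/
lemma continuous_mutualInfo (p q : ℝ) : Continuous (mutualInfo p q) := by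
  unfold mutualInfo
  simp only [H2_eq_binEntropy_div]
  fun_prop

lemma bddAbove_mutualInfo (p q : ℝ) :
    BddAbove {x | ∃ s ∈ Set.Icc (0 : ℝ) 1, x = mutualInfo p q s} := by
  obtain ⟨b, hb⟩ := isCompact_Icc.bddAbove_image (K := Set.Icc (0 : ℝ) 1)
    (continuous_mutualInfo p q).continuousOn
  refine ⟨b, ?_⟩
  rintro _ ⟨s, hs, rfl⟩
  exact hb ⟨s, hs, rfl⟩

/-- The cellwise bound behind the subadditivity of entropy, for a cell of mass `x / 2` in a row
of mass `r` and a column of mass `k`. -/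
lemma half_mul_log_le {x r k : ℝ} (hx : 0 ≤ x) (hr : x / 2 ≤ r) (hk : x / 2 ≤ k) :
    x / 2 * (Real.log r + Real.log k + Real.log 2 - Real.log x) ≤ r * k - x / 2 := by
  rcases hx.eq_or_lt with rfl | hx
  · norm_num at hr hk ⊢
    positivity
  · have hr₀ : 0 < r := by linarith
    have hk₀ : 0 < k := by linarith
    have h := Real.log_le_sub_one_of_pos (x := r * k * 2 / x) (by positivity)
    rw [Real.log_div (by positivity) hx.ne', Real.log_mul (by positivity) two_ne_zero,
      Real.log_mul hr₀.ne' hk₀.ne'] at h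
    calc x / 2 * (Real.log r + Real.log k + Real.log 2 - Real.log x)
        ≤ x / 2 * (r * k * 2 / x - 1) := by gcongr
      _ = r * k - x / 2 := by field_simp

/-- Fano's inequality for a bit channel with uniform prior. -/
lemma one_sub_H2_le_mutualInfo_half {p q : ℝ} (hp₀ : 0 ≤ p) (hp₁ : p ≤ 1) (hq₀ : 0 ≤ q)
    (hq₁ : q ≤ 1) : 1 - H2 ((p + q) / 2) ≤ mutualInfo p q (1 / 2) := by
  have hlog : 0 < Real.log 2 := Real.log_pos one_lt_two
  obtain ⟨u, hu⟩ : ∃ u, u = 1 / 2 * q + (1 - 1 / 2) * (1 - p) := ⟨_, rfl⟩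
  obtain ⟨e, he⟩ : ∃ e, e = (p + q) / 2 := ⟨_, rfl⟩
  have h₁ := half_mul_log_le (x := q) (r := u) (k := e) hq₀ (by linarith) (by linarith)
  have h₂ := half_mul_log_le (x := 1 - p) (r := u) (k := 1 - e)
    (by linarith) (by linarith) (by linarith)
  have h₃ := half_mul_log_le (x := p) (r := 1 - u) (k := e) hp₀ (by linarith) (by linarith)
  have h₄ := half_mul_log_le (x := 1 - q) (r := 1 - u) (k := 1 - e)
    (by linarith) (by linarith) (by linarith)
  have key : Real.log 2 - Real.binEntropy e ≤
      Real.binEntropy u - 1 / 2 * Real.binEntropy q - (1 - 1 / 2) * Real.binEntropy p := by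
    simp only [Real.binEntropy, Real.log_inv]
    have hsum := add_le_add (add_le_add h₁ h₂) (add_le_add h₃ h₄)
    generalize Real.log u = a, Real.log (1 - u) = b, Real.log e = c,
      Real.log (1 - e) = d at hsum ⊢
    subst hu he
    linarith
  unfold mutualInfo
  rw [← hu, ← he]
  simp only [H2_eq_binEntropy_div]
  calc 1 - Real.binEntropy e / Real.log 2
      = (Real.log 2 - Real.binEntropy e) / Real.log 2 := by field_simp
    _ ≤ _ := div_le_div_of_nonneg_right key hlog.le
    _ = _ := by ring

/-- The Shannon capacity of a bit channel `B` is at least the capacity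
`1 - H₂((p+q)/2)` of the binary symmetric channel obtained by symmetrizing `B`, where
`p = p_B(0|1)` and `q = p_B(1|0)`. -/
theorem capacity_ge_symmetrized
    (pB : Fin 2 → Fin 2 → ℝ)
    (hBnn : ∀ m' m, 0 ≤ pB m' m)
    (hBsum : ∀ m, ∑ m', pB m' m = 1) :
    1 - H2 ((pB 0 1 + pB 1 0) / 2) ≤ capacity (pB 0 1) (pB 1 0) := by
  have h₀ := hBsum 0
  have h₁ := hBsum 1
  rw [Fin.sum_univ_two] at h₀ h₁
  refine (one_sub_H2_le_mutualInfo_half (hBnn 0 1) ?_ (hBnn 1 0) ?_).trans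
    (le_csSup (bddAbove_mutualInfo _ _) ⟨1 / 2, by norm_num, rfl⟩)
  · linarith [hBnn 1 1]
  · linarith [hBnn 0 0]
end

section
/- For d ≤ 2 there is no simulation of the 4-dimensional NOT channel p_NOT using a noiseless bit channel and shared randomness of dimension d: there exist no probability distribution (p_{ij}) on {1,…,d}², encodings p_enc^{(i)}(m|b) (probability distributions over m ∈ {0,1}) and decodings p_dec^{(j)}(y|m) (probability distributions over y ∈ {1,2,3,4}) such that Σ_{i,j} p_{ij} Σ_{m∈{0,1}} p_dec^{(j)}(y|m) p_enc^{(i)}(m|b) = p_NOT(y|b) for all y, b ∈ {1,2,3,4}. Hence every such simulation requires shared correlated classical systems of dimension at least 3. -/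
/-- A family of fewer than `n` linear functionals on `ℝⁿ` has a common nonzero kernel vector. -/
theorem exists_ne_zero_forall_sum_mul_eq_zero {ι κ : Type*} [Fintype ι] [Fintype κ]
    (h : Fintype.card ι < Fintype.card κ) (A : ι → κ → ℝ) :
    ∃ x : κ → ℝ, x ≠ 0 ∧ ∀ i, ∑ b, A i b * x b = 0 := by
  have hker : LinearMap.ker (Matrix.mulVecLin (Matrix.of A)) ≠ ⊥ :=
    LinearMap.ker_ne_bot_of_finrank_lt (by simpa using h)
  obtain ⟨x, hx, hx0⟩ := Submodule.exists_mem_ne_zero_of_ne_bot hker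
  exact ⟨x, hx0, fun i => congrFun (LinearMap.mem_ker.mp hx) i⟩

/-- For `d ≤ 2` there is no simulation of the 4-dimensional NOT channel
`p_NOT(y|b) = (1 − δ_{y,b})/3` using a noiseless bit channel and shared randomness of
dimension `d`; hence every such simulation requires shared correlated classical systems
of dimension at least 3. -/
theorem no_not_simulation_with_dim_le_two
    (d : ℕ) (hd : d ≤ 2) :
    ¬ ∃ (pr : Fin d → Fin d → ℝ) (penc : Fin d → Fin 4 → Fin 2 → ℝ)
        (pdec : Fin d → Fin 2 → Fin 4 → ℝ),
      (∀ i j, 0 ≤ pr i j) ∧ (∑ i, ∑ j, pr i j = 1) ∧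
      (∀ i b m, 0 ≤ penc i b m) ∧ (∀ i b, ∑ m, penc i b m = 1) ∧
      (∀ j m y, 0 ≤ pdec j m y) ∧ (∀ j m, ∑ y, pdec j m y = 1) ∧
      (∀ y b, ∑ i, ∑ j, pr i j * ∑ m, pdec j m y * penc i b m
        = if y = b then 0 else 1 / 3) := by
  rintro ⟨pr, penc, pdec, -, -, -, henc, -, -, hsim⟩
  -- The simulated channel has rank at most `d + 1`, while the NOT channel has rank 4.
  obtain ⟨x, hx0, hx⟩ := exists_ne_zero_forall_sum_mul_eq_zero
    (ι := Option (Fin d)) (κ := Fin 4) (by simp; omega)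
    (fun o b => o.elim 1 fun i => penc i b 0)
  have hsum : ∑ b, x b = 0 := by simpa using hx none
  have hzero (i : Fin d) : ∑ b, penc i b 0 * x b = 0 := hx (some i)
  have hone (i : Fin d) : ∑ b, penc i b 1 * x b = 0 := by
    have h (b : Fin 4) : penc i b 1 * x b = x b - penc i b 0 * x b := by
      have := henc i b
      rw [Fin.sum_univ_two] at this
      linear_combination x b * this
    simp only [h, Finset.sum_sub_distrib, hsum, hzero, sub_zero]
  refine hx0 (funext fun y => ?_)
  have hleft : ∑ b, (∑ i, ∑ j, pr i j * ∑ m, pdec j m y * penc i b m) * x b = 0 := by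
    simp only [Finset.sum_mul]
    rw [Finset.sum_comm]
    refine Finset.sum_eq_zero fun i _ => ?_
    rw [Finset.sum_comm]
    refine Finset.sum_eq_zero fun j _ => ?_
    calc ∑ b, (pr i j * ∑ m, pdec j m y * penc i b m) * x b
        = pr i j * pdec j 0 y * ∑ b, penc i b 0 * x b
          + pr i j * pdec j 1 y * ∑ b, penc i b 1 * x b := by
          rw [Finset.mul_sum, Finset.mul_sum, ← Finset.sum_add_distrib]
          refine Finset.sum_congr rfl fun b _ => ?_
          rw [Fin.sum_univ_two]
          ring
      _ = 0 := by rw [hzero, hone, mul_zero, mul_zero, add_zero]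
  have hright : ∑ b, (if y = b then (0 : ℝ) else 1 / 3) * x b = (∑ b, x b - x y) / 3 := by
    have h (b : Fin 4) : (if y = b then (0 : ℝ) else 1 / 3) * x b
        = 1 / 3 * x b - if y = b then 1 / 3 * x b else 0 := by
      split_ifs <;> ring
    simp only [h, Finset.sum_sub_distrib, ← Finset.mul_sum, Finset.sum_ite_eq,
      Finset.mem_univ, if_true]
    ring
  simp only [hsim] at hleft
  rw [hright, hsum] at hleft
  simp only [Pi.zero_apply]
  linarith
end

section
/- Let S_0, S_1, S_2 be three off-diagonal strategies without shared randomness with induced conditional distributions p_{S_0}(y|b), p_{S_1}(y|b), p_{S_2}(y|b), and let q_0, q_1, q_2 ≥ 0 with q_0 + q_1 + q_2 = 1 satisfy Σ_{i∈{0,1,2}} q_i · p_{S_i}(y|b) = p_NOT(y|b) = (1 − δ_{y,b})/3 for all y, b ∈ {1,2,3,4}. Then q_0 = q_1 = q_2 = 1/3. In particular, every simulation of p_NOT using a noiseless bit channel and two perfectly correlated three-dimensional classical systems requires the shared randomness to be uniform, corresponding to log₂ 3 shared random bits. -/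
/-- With one bit of communication, the total probability of answering `σ b` on input `b`,
summed over the inputs, is at most two. -/
lemma sum_channel_perm_le_two {α : Type*} [Fintype α]
    (d : Fin 2 → α → ℝ) (e : α → Fin 2 → ℝ)
    (hd : ∀ m y, 0 ≤ d m y) (hds : ∀ m, ∑ y, d m y = 1)
    (he : ∀ b m, 0 ≤ e b m) (hes : ∀ b, ∑ m, e b m = 1) (σ : Equiv.Perm α) :
    ∑ b, ∑ m, d m (σ b) * e b m ≤ 2 := by
  have he1 (b : α) (m : Fin 2) : e b m ≤ 1 :=
    hes b ▸ Finset.single_le_sum (fun k _ => he b k) (Finset.mem_univ m)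
  calc ∑ b, ∑ m, d m (σ b) * e b m ≤ ∑ b, ∑ m, d m (σ b) := by
        gcongr with b _ m _
        exact mul_le_of_le_one_right (hd _ _) (he1 _ _)
    _ = ∑ m, ∑ b, d m (σ b) := Finset.sum_comm
    _ = ∑ m : Fin 2, (1 : ℝ) := by
        refine Finset.sum_congr rfl fun m _ => ?_
        rw [Equiv.sum_comp σ (d m), hds]
    _ = 2 := by simp

/-- In an off-diagonal strategy the two decoding distributions have disjoint supports. -/
lemma decoding_eq_zero_or_eq_zero {α : Type*} (d : Fin 2 → α → ℝ) (e : α → Fin 2 → ℝ)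
    (hes : ∀ b, ∑ m, e b m = 1) (h0 : ∀ m b, d m b * e b m = 0) (b : α) :
    d 0 b = 0 ∨ d 1 b = 0 := by
  have hs := hes b
  rw [Fin.sum_univ_two] at hs
  rcases mul_eq_zero.1 (h0 0 b) with h | h
  · exact .inl h
  · rcases mul_eq_zero.1 (h0 1 b) with h' | h'
    · exact .inr h'
    · linarith

/-- If every output probability of an off-diagonal strategy is below one, then so is every
decoding probability. -/
lemma decoding_lt_one {α : Type*} [Fintype α] (d : Fin 2 → α → ℝ) (e : α → Fin 2 → ℝ)
    (hds : ∀ m, ∑ y, d m y = 1)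
    (hes : ∀ b, ∑ m, e b m = 1) (h0 : ∀ m b, d m b * e b m = 0)
    (hlt : ∀ y b, ∑ m, d m y * e b m < 1) (m : Fin 2) (y : α) : d m y < 1 := by
  obtain ⟨b, -, hb⟩ : ∃ b ∈ Finset.univ, d (1 - m) b ≠ 0 :=
    Finset.exists_ne_zero_of_sum_ne_zero (by rw [hds]; exact one_ne_zero)
  have hz : e b (1 - m) = 0 := (mul_eq_zero.1 (h0 (1 - m) b)).resolve_left hb
  have hs := hes b
  have hl := hlt y b
  rw [Fin.sum_univ_two] at hs hl
  clear hds hes h0 hlt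
  fin_cases m <;> simp_all

/-- If every decoding probability of an off-diagonal strategy on four letters is below one,
then some fixed-point-free permutation `σ` has `σ b` never answered on input `b`. -/
lemma exists_perm_channel_eq_zero (d : Fin 2 → Fin 4 → ℝ) (e : Fin 4 → Fin 2 → ℝ)
    (hds : ∀ m, ∑ y, d m y = 1)
    (hes : ∀ b, ∑ m, e b m = 1) (h0 : ∀ m b, d m b * e b m = 0)
    (hlt : ∀ m y, d m y < 1) :
    ∃ σ : Equiv.Perm (Fin 4), ∀ b, σ b ≠ b ∧ ∑ m, d m (σ b) * e b m = 0 := by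
  have hdisj := decoding_eq_zero_or_eq_zero d e hes h0
  have hpair (x y : Fin 4) (h : (d 0 x = 0 ∧ d 1 y ≠ 0) ∨ (d 1 x = 0 ∧ d 0 y ≠ 0)) :
      ∑ m, d m x * e y m = 0 := by
    rw [Fin.sum_univ_two]
    rcases h with ⟨hx, hy⟩ | ⟨hx, hy⟩
    · rw [hx, (mul_eq_zero.1 (h0 1 y)).resolve_left hy]; simp
    · rw [hx, (mul_eq_zero.1 (h0 0 y)).resolve_left hy]; simp
  have hs0 := hds 0
  have hs1 := hds 1
  have hl0 := hlt 0
  have hl1 := hlt 1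
  simp only [Fin.sum_univ_four] at hs0 hs1
  have key : (∀ b, ∑ m, d m ((Equiv.swap 0 1 * Equiv.swap 2 3 : Equiv.Perm (Fin 4)) b) * e b m = 0)
      ∨ (∀ b, ∑ m, d m ((Equiv.swap 0 2 * Equiv.swap 1 3 : Equiv.Perm (Fin 4)) b) * e b m = 0)
      ∨ (∀ b, ∑ m, d m ((Equiv.swap 0 3 * Equiv.swap 1 2 : Equiv.Perm (Fin 4)) b) * e b m = 0) := by
    have hswap01 (b : Fin 4) :
        (Equiv.swap 0 1 * Equiv.swap 2 3 : Equiv.Perm (Fin 4)) b = ![1, 0, 3, 2] b := by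
      revert b; decide
    have hswap02 (b : Fin 4) :
        (Equiv.swap 0 2 * Equiv.swap 1 3 : Equiv.Perm (Fin 4)) b = ![2, 3, 0, 1] b := by
      revert b; decide
    have hswap03 (b : Fin 4) :
        (Equiv.swap 0 3 * Equiv.swap 1 2 : Equiv.Perm (Fin 4)) b = ![3, 2, 1, 0] b := by
      revert b; decide
    have hall (τ : Fin 4 → Fin 4)
        (h : ∀ b, (d 0 (τ b) = 0 ∧ d 1 b ≠ 0) ∨ (d 1 (τ b) = 0 ∧ d 0 b ≠ 0)) :
        ∀ b, ∑ m, d m (τ b) * e b m = 0 := fun b => hpair _ _ (h b)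
    simp_rw [hswap01, hswap02, hswap03]
    refine Or.imp (hall _) (Or.imp (hall _) (hall _)) ?_
    simp [Fin.forall_fin_succ] at hdisj hl0 hl1 ⊢
    clear hall hpair hswap01 hswap02 hswap03 hds hes h0 hlt
    obtain ⟨h | h, h' | h', h'' | h'', h''' | h'''⟩ := hdisj <;> grind
  rcases key with h | h | h
  · exact ⟨_, fun b => ⟨by revert b; decide, h b⟩⟩
  · exact ⟨_, fun b => ⟨by revert b; decide, h b⟩⟩
  · exact ⟨_, fun b => ⟨by revert b; decide, h b⟩⟩

/-- If three off-diagonal strategies without shared randomness (one bit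
of communication each) are mixed with probabilities `q₀, q₁, q₂` so as to reproduce the
4-dimensional NOT channel `p_NOT(y|b) = (1 − δ_{y,b})/3`, then `q₀ = q₁ = q₂ = 1/3`:
the shared randomness must be uniform, corresponding to `log₂ 3` shared random bits. -/
theorem not_simulation_requires_uniform_randomness
    (penc : Fin 3 → Fin 4 → Fin 2 → ℝ) (pdec : Fin 3 → Fin 2 → Fin 4 → ℝ)
    (hencnn : ∀ i b m, 0 ≤ penc i b m) (hencsum : ∀ i b, ∑ m, penc i b m = 1)
    (hdecnn : ∀ i m y, 0 ≤ pdec i m y) (hdecsum : ∀ i m, ∑ y, pdec i m y = 1)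
    (hoff : ∀ i b, ∑ m, pdec i m b * penc i b m = 0)
    (q : Fin 3 → ℝ) (hqnn : ∀ i, 0 ≤ q i) (hqsum : ∑ i, q i = 1)
    (hsim : ∀ y b, ∑ i, q i * ∑ m, pdec i m y * penc i b m
      = if y = b then 0 else 1 / 3) :
    ∀ i, q i = 1 / 3 := by
  have hoff' (i : Fin 3) (m : Fin 2) (b : Fin 4) : pdec i m b * penc i b m = 0 :=
    (Finset.sum_eq_zero_iff_of_nonneg
      fun m _ => mul_nonneg (hdecnn i m b) (hencnn i b m)).1 (hoff i b) m (Finset.mem_univ m)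
  have hle (i : Fin 3) : q i ≤ 1 / 3 := by
    by_contra! hi
    have hlt (y b : Fin 4) : ∑ m, pdec i m y * penc i b m < 1 := by
      by_contra! h1
      have hterm : q i * ∑ m, pdec i m y * penc i b m
          ≤ ∑ j, q j * ∑ m, pdec j m y * penc j b m :=
        Finset.single_le_sum (f := fun j => q j * ∑ m, pdec j m y * penc j b m)
          (fun j _ => mul_nonneg (hqnn j)
            (Finset.sum_nonneg fun m _ => mul_nonneg (hdecnn j m y) (hencnn j b m)))
          (Finset.mem_univ i)
      rw [hsim] at hterm
      have := le_mul_of_one_le_right (hqnn i) h1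
      split_ifs at hterm <;> linarith
    obtain ⟨σ, hσ⟩ := exists_perm_channel_eq_zero (pdec i) (penc i) (hdecsum i) (hencsum i)
      (hoff' i) (decoding_lt_one _ _ (hdecsum i) (hencsum i) (hoff' i) hlt)
    have htotal : ∑ j, q j * ∑ b, ∑ m, pdec j m (σ b) * penc j b m = 4 / 3 := by
      simp_rw [Finset.mul_sum (s := (Finset.univ : Finset (Fin 4)))]
      rw [Finset.sum_comm]
      simp_rw [hsim]
      simp only [(hσ _).1, if_false]
      norm_num
    have hbound : ∑ j, q j * ∑ b, ∑ m, pdec j m (σ b) * penc j b m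
        ≤ ∑ j, (2 * q j - if j = i then 2 * q i else 0) := by
      refine Finset.sum_le_sum fun j _ => ?_
      split_ifs with hj
      · subst hj
        simp [hσ]
      · have := mul_le_mul_of_nonneg_left (sum_channel_perm_le_two (pdec j) (penc j)
          (hdecnn j) (hdecsum j) (hencnn j) (hencsum j) σ) (hqnn j)
        linarith
    rw [htotal, Finset.sum_sub_distrib, ← Finset.mul_sum, hqsum] at hbound
    simp only [Finset.sum_ite_eq', Finset.mem_univ, if_true] at hbound
    linarith
  rw [Fin.sum_univ_three] at hqsum
  have h0 := hle 0
  have h1 := hle 1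
  have h2 := hle 2
  intro i
  fin_cases i <;> simp only [Fin.zero_eta, Fin.mk_one, Fin.reduceFinMk] <;> linarith
end

section
/- Let S be an off-diagonal strategy without shared randomness with supports B_0 and B_1. If |B_0| = 1 or |B_1| = 1 (i.e., S is of type (1,1), (1,2), or (1,3)), then there exist y ≠ b in {1,2,3,4} with induced probability p(y|b) = 1; i.e., the strategy matrix contains a 1 in some off-diagonal position. -/
/-- A nonnegative weight of total mass `1` with a single point in its support is a point mass. -/
theorem exists_eq_one_of_ncard_support_eq_one {ι : Type*} [Fintype ι] {f : ι → ℝ}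
    (hnn : ∀ y, 0 ≤ f y) (hsum : ∑ y, f y = 1) (hcard : {y | 0 < f y}.ncard = 1) :
    ∃ y, f y = 1 := by
  obtain ⟨a, ha⟩ := Set.ncard_eq_one.mp hcard
  refine ⟨a, ?_⟩
  rw [← hsum, Fintype.sum_eq_single a]
  intro y hy
  have hnot : y ∉ {y | 0 < f y} := by simpa [ha] using hy
  exact le_antisymm (not_lt.mp hnot) (hnn y)

/-- An off-diagonal mixture of two product strategies, with encoding weights `u`, `v` and output
distributions `f`, `g`, has an off-diagonal `1` as soon as `f` is a point mass. -/
theorem exists_offdiagonal_one_of_point_mass {ι : Type*} [Fintype ι] {u v f g : ι → ℝ}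
    (hu : ∀ b, 0 ≤ u b) (hv : ∀ b, 0 ≤ v b) (huv : ∀ b, u b + v b = 1)
    (hf : ∀ y, 0 ≤ f y) (hg : ∀ y, 0 ≤ g y) (hgsum : ∑ y, g y = 1)
    (hoff : ∀ b, f b * u b + g b * v b = 0) {a : ι} (ha : f a = 1) :
    ∃ y b, y ≠ b ∧ f y * u b + g y * v b = 1 := by
  have hzero (b : ι) : f b * u b = 0 ∧ g b * v b = 0 :=
    (add_eq_zero_iff_of_nonneg (mul_nonneg (hf b) (hu b)) (mul_nonneg (hg b) (hv b))).mp (hoff b)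
  have hua : u a = 0 := by simpa [ha] using (hzero a).1
  have hva : v a = 1 := by simpa [hua] using huv a
  have hga : g a = 0 := by simpa [hva] using (hzero a).2
  obtain ⟨b, -, hb⟩ : ∃ b ∈ Finset.univ, g b ≠ 0 :=
    Finset.exists_ne_zero_of_sum_ne_zero (by simp [hgsum])
  have hvb : v b = 0 := (mul_eq_zero.mp (hzero b).2).resolve_left hb
  have hub : u b = 1 := by simpa [hvb] using huv b
  refine ⟨a, b, ?_, by simp [ha, hub, hvb]⟩
  rintro rfl
  exact hb hga

/-- If an off-diagonal strategy without shared randomness has a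
singleton support (`|B₀| = 1` or `|B₁| = 1`, i.e. it is of type (1,1), (1,2) or (1,3)),
then its strategy matrix contains a `1` in some off-diagonal position: there exist
`y ≠ b` with `p(y|b) = 1`. -/
theorem singleton_support_gives_offdiagonal_one
    (penc : Fin 4 → Fin 2 → ℝ) (pdec : Fin 2 → Fin 4 → ℝ)
    (hencnn : ∀ b m, 0 ≤ penc b m) (hencsum : ∀ b, ∑ m, penc b m = 1)
    (hdecnn : ∀ m y, 0 ≤ pdec m y) (hdecsum : ∀ m, ∑ y, pdec m y = 1)
    (p : Fin 4 → Fin 4 → ℝ)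
    (hp : ∀ y b, p y b = ∑ m, pdec m y * penc b m)
    (hoff : ∀ b, p b b = 0)
    (hcard : {y | 0 < pdec 0 y}.ncard = 1 ∨ {y | 0 < pdec 1 y}.ncard = 1) :
    ∃ y b, y ≠ b ∧ p y b = 1 := by
  simp only [hp, Fin.sum_univ_two] at hoff hencsum ⊢
  rcases hcard with h | h
  · obtain ⟨a, ha⟩ := exists_eq_one_of_ncard_support_eq_one (hdecnn 0) (hdecsum 0) h
    exact exists_offdiagonal_one_of_point_mass (fun b => hencnn b 0) (fun b => hencnn b 1)
      hencsum (hdecnn 0) (hdecnn 1) (hdecsum 1) hoff ha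
  · obtain ⟨a, ha⟩ := exists_eq_one_of_ncard_support_eq_one (hdecnn 1) (hdecsum 1) h
    simp only [add_comm (pdec 0 _ * _)] at hoff ⊢
    exact exists_offdiagonal_one_of_point_mass (fun b => hencnn b 1) (fun b => hencnn b 0)
      (fun b => (add_comm _ _).trans (hencsum b)) (hdecnn 1) (hdecnn 0) (hdecsum 0) hoff ha
end

section
/- Let S and S' be off-diagonal strategies without shared randomness with supports (B_0, B_1) and (B'_0, B'_1) respectively. If |B_0| = |B_1| = 2 (S is of type (2,2)) and min(|B'_0|, |B'_1|) = 1 (S' is of a type other than (2,2)), then there exist k ≠ l in {1,2,3,4} with p_S(k|l) = 0 and p_{S'}(k|l) = 0; i.e., the two strategy matrices have a 0 in the same off-diagonal position. -/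
section TwoMessages

variable {Y : Type*} {e₀ e₁ d₀ d₁ : Y → ℝ}

/-- Off the diagonal, a symbol in one decoding support lies outside the other one, and it is
never encoded by the message whose support contains it. -/
lemma decoder_eq_zero_and_encoder_eq_zero
    (he₀ : ∀ b, 0 ≤ e₀ b) (he₁ : ∀ b, 0 ≤ e₁ b) (he : ∀ b, e₀ b + e₁ b = 1)
    (hd₀ : ∀ y, 0 ≤ d₀ y) (hd₁ : ∀ y, 0 ≤ d₁ y)
    (hoff : ∀ b, d₀ b * e₀ b + d₁ b * e₁ b = 0) {y : Y} (hy : 0 < d₀ y) :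
    d₁ y = 0 ∧ e₀ y = 0 := by
  have h₀ := mul_nonneg (hd₀ y) (he₀ y)
  have h₁ := mul_nonneg (hd₁ y) (he₁ y)
  have hey : e₀ y = 0 :=
    (mul_eq_zero.mp (by linarith [hoff y] : d₀ y * e₀ y = 0)).resolve_left hy.ne'
  have he₁y : e₁ y = 1 := by linarith [he y]
  have := hoff y
  rw [hey, he₁y] at this
  exact ⟨by linarith, hey⟩

/-- Two symbols in the same decoding support of an off-diagonal strategy are never output
for one another. -/
lemma output_eq_zero_of_same_support
    (he₀ : ∀ b, 0 ≤ e₀ b) (he₁ : ∀ b, 0 ≤ e₁ b) (he : ∀ b, e₀ b + e₁ b = 1)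
    (hd₀ : ∀ y, 0 ≤ d₀ y) (hd₁ : ∀ y, 0 ≤ d₁ y)
    (hoff : ∀ b, d₀ b * e₀ b + d₁ b * e₁ b = 0) {k l : Y} (hk : 0 < d₀ k) (hl : 0 < d₀ l) :
    d₀ k * e₀ l + d₁ k * e₁ l = 0 := by
  simp [(decoder_eq_zero_and_encoder_eq_zero he₀ he₁ he hd₀ hd₁ hoff hk).1,
    (decoder_eq_zero_and_encoder_eq_zero he₀ he₁ he hd₀ hd₁ hoff hl).2]

/-- If two symbols lie outside one decoding support of an off-diagonal strategy, then one of
them is never output for the other. -/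
lemma output_eq_zero_or_of_not_mem_support
    (hoff : ∀ b, d₀ b * e₀ b + d₁ b * e₁ b = 0) {k l : Y} (hk : d₀ k = 0) (hl : d₀ l = 0) :
    d₀ k * e₀ l + d₁ k * e₁ l = 0 ∨ d₀ l * e₀ k + d₁ l * e₁ k = 0 := by
  have h := hoff l
  rw [hl, zero_mul, zero_add, mul_eq_zero] at h
  rcases h with h | h
  · right; simp [hl, h]
  · left; simp [hk, h]

/-- Given a symbol `a`, one of two disjoint two-element supports avoids `a`, hence supplies two
distinct symbols other than `a` which an off-diagonal strategy never outputs for one another. -/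
lemma exists_pair_output_eq_zero
    (he₀ : ∀ b, 0 ≤ e₀ b) (he₁ : ∀ b, 0 ≤ e₁ b) (he : ∀ b, e₀ b + e₁ b = 1)
    (hd₀ : ∀ y, 0 ≤ d₀ y) (hd₁ : ∀ y, 0 ≤ d₁ y)
    (hoff : ∀ b, d₀ b * e₀ b + d₁ b * e₁ b = 0)
    (hcard₀ : {y | 0 < d₀ y}.ncard = 2) (hcard₁ : {y | 0 < d₁ y}.ncard = 2) (a : Y) :
    ∃ k l, k ≠ l ∧ k ≠ a ∧ l ≠ a ∧
      d₀ k * e₀ l + d₁ k * e₁ l = 0 ∧ d₀ l * e₀ k + d₁ l * e₁ k = 0 := by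
  have hmem {d : Y → ℝ} {k l : Y} (h : {y | 0 < d y} = {k, l}) : 0 < d k ∧ 0 < d l :=
    ⟨h.ge (Set.mem_insert k {l}), h.ge (Set.mem_insert_of_mem k rfl)⟩
  by_cases ha : 0 < d₀ a
  · have ha₁ := (decoder_eq_zero_and_encoder_eq_zero he₀ he₁ he hd₀ hd₁ hoff ha).1
    obtain ⟨k, l, hkl, h⟩ := Set.ncard_eq_two.mp hcard₁
    obtain ⟨hk, hl⟩ := hmem h
    have he' : ∀ b, e₁ b + e₀ b = 1 := fun b => by rw [add_comm, he]
    have hoff' : ∀ b, d₁ b * e₁ b + d₀ b * e₀ b = 0 := fun b => by rw [add_comm, hoff]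
    refine ⟨k, l, hkl, by rintro rfl; exact hk.ne' ha₁, by rintro rfl; exact hl.ne' ha₁, ?_, ?_⟩
    · rw [add_comm]
      exact output_eq_zero_of_same_support he₁ he₀ he' hd₁ hd₀ hoff' hk hl
    · rw [add_comm]
      exact output_eq_zero_of_same_support he₁ he₀ he' hd₁ hd₀ hoff' hl hk
  · obtain ⟨k, l, hkl, h⟩ := Set.ncard_eq_two.mp hcard₀
    obtain ⟨hk, hl⟩ := hmem h
    exact ⟨k, l, hkl, by rintro rfl; exact ha hk, by rintro rfl; exact ha hl,
      output_eq_zero_of_same_support he₀ he₁ he hd₀ hd₁ hoff hk hl,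
      output_eq_zero_of_same_support he₀ he₁ he hd₀ hd₁ hoff hl hk⟩

/-- If one decoding support of an off-diagonal strategy is a singleton `{a}`, then among any two
symbols other than `a`, one is never output for the other. -/
lemma exists_output_eq_zero_or_of_ncard_eq_one
    (hoff : ∀ b, d₀ b * e₀ b + d₁ b * e₁ b = 0) (hd₀ : ∀ y, 0 ≤ d₀ y)
    (hcard : {y | 0 < d₀ y}.ncard = 1) :
    ∃ a, ∀ k l, k ≠ a → l ≠ a →
      d₀ k * e₀ l + d₁ k * e₁ l = 0 ∨ d₀ l * e₀ k + d₁ l * e₁ k = 0 := by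
  obtain ⟨a, ha⟩ := Set.ncard_eq_one.mp hcard
  have hzero {y : Y} (hy : y ≠ a) : d₀ y = 0 :=
    le_antisymm (not_lt.mp fun h => hy (ha.le h)) (hd₀ y)
  exact ⟨a, fun k l hk hl =>
    output_eq_zero_or_of_not_mem_support hoff (hzero hk) (hzero hl)⟩

end TwoMessages

/-- If `S` is an off-diagonal strategy without shared randomness of
type (2,2) (both supports have two elements) and `S'` is an off-diagonal strategy of a
type other than (2,2) (one of its supports is a singleton), then the two strategy
matrices have a `0` in the same off-diagonal position: there exist `k ≠ l` with
`p_S(k|l) = 0` and `p_{S'}(k|l) = 0`. -/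
theorem type_two_two_vs_other_common_zero
    (penc : Fin 4 → Fin 2 → ℝ) (pdec : Fin 2 → Fin 4 → ℝ)
    (hencnn : ∀ b m, 0 ≤ penc b m) (hencsum : ∀ b, ∑ m, penc b m = 1)
    (hdecnn : ∀ m y, 0 ≤ pdec m y) (hdecsum : ∀ m, ∑ y, pdec m y = 1)
    (pS : Fin 4 → Fin 4 → ℝ)
    (hpS : ∀ y b, pS y b = ∑ m, pdec m y * penc b m)
    (hoffS : ∀ b, pS b b = 0)
    (hScard : {y | 0 < pdec 0 y}.ncard = 2 ∧ {y | 0 < pdec 1 y}.ncard = 2)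
    (penc' : Fin 4 → Fin 2 → ℝ) (pdec' : Fin 2 → Fin 4 → ℝ)
    (hencnn' : ∀ b m, 0 ≤ penc' b m) (hencsum' : ∀ b, ∑ m, penc' b m = 1)
    (hdecnn' : ∀ m y, 0 ≤ pdec' m y) (hdecsum' : ∀ m, ∑ y, pdec' m y = 1)
    (pS' : Fin 4 → Fin 4 → ℝ)
    (hpS' : ∀ y b, pS' y b = ∑ m, pdec' m y * penc' b m)
    (hoffS' : ∀ b, pS' b b = 0)
    (hS'card : min ({y | 0 < pdec' 0 y}.ncard) ({y | 0 < pdec' 1 y}.ncard) = 1) :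
    ∃ k l, k ≠ l ∧ pS k l = 0 ∧ pS' k l = 0 := by
  simp only [Fin.sum_univ_two] at hencsum hencsum' hpS hpS'
  simp only [hpS] at hoffS ⊢
  simp only [hpS'] at hoffS' ⊢
  obtain ⟨a, ha⟩ : ∃ a, ∀ k l, k ≠ a → l ≠ a →
      pdec' 0 k * penc' l 0 + pdec' 1 k * penc' l 1 = 0 ∨
        pdec' 0 l * penc' k 0 + pdec' 1 l * penc' k 1 = 0 := by
    rcases min_choice ({y | 0 < pdec' 0 y}.ncard) ({y | 0 < pdec' 1 y}.ncard) with h | h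
    · exact exists_output_eq_zero_or_of_ncard_eq_one (e₀ := (penc' · 0)) (e₁ := (penc' · 1))
        hoffS' (hdecnn' 0) (h ▸ hS'card)
    · simp only [add_comm (pdec' 0 _ * _)] at hoffS' ⊢
      exact exists_output_eq_zero_or_of_ncard_eq_one (e₀ := (penc' · 1)) (e₁ := (penc' · 0))
        hoffS' (hdecnn' 1) (h ▸ hS'card)
  obtain ⟨k, l, hkl, hk, hl, hS, hS'⟩ :=
    exists_pair_output_eq_zero (e₀ := (penc · 0)) (e₁ := (penc · 1)) (hencnn · 0) (hencnn · 1)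
      hencsum (hdecnn 0) (hdecnn 1) hoffS hScard.1 hScard.2 a
  rcases ha k l hk hl with h | h
  · exact ⟨k, l, hkl, hS, h⟩
  · exact ⟨l, k, hkl.symm, hS', h⟩
end

section
/- Let Φ⁺ ∈ ℂ^{2×2} (a vector indexed by Fin 2 × Fin 2) be Φ⁺ = (e₀⊗e₀ + e₁⊗e₁)/√2, let U₁ = I, U₂ = X, U₃ = Y, U₄ = Z, and define the Bell vectors Φ_b = (U_b ⊗ I)·Φ⁺ for b ∈ {1,2,3,4}. Let N be the linear map on 4×4 complex matrices (indexed by Fin 2 × Fin 2) representing UNOT ⊗ id, given entrywise by N(M)_{(a,b'),(c,d)} = (2/3)·δ_{a,c}·(Σ_{e∈Fin 2} M_{(e,b'),(e,d)}) − (1/3)·M_{(a,b'),(c,d)}. Then for all b, y ∈ {1,2,3,4}: ⟨Φ_y, N(Φ_b Φ_b^*)·Φ_y⟩ = (1 − δ_{y,b})/3. In particular, in the UNOT dense-coding protocol Bob's Bell-measurement outcome never equals the bomb position b, and equals each y ≠ b with probability 1/3. -/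
/-- The Pauli matrix `X`. -/
noncomputable def pauliX : Matrix (Fin 2) (Fin 2) ℂ := !![0, 1; 1, 0]

/-- The Pauli matrix `Y`. -/
noncomputable def pauliY : Matrix (Fin 2) (Fin 2) ℂ := !![0, -Complex.I; Complex.I, 0]

/-- The Pauli matrix `Z`. -/
noncomputable def pauliZ : Matrix (Fin 2) (Fin 2) ℂ := !![1, 0; 0, -1]

/-- The unitaries `U₁ = I`, `U₂ = X`, `U₃ = Y`, `U₄ = Z` used by Alice's encoding. -/
noncomputable def pauliU : Fin 4 → Matrix (Fin 2) (Fin 2) ℂ := ![1, pauliX, pauliY, pauliZ]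

/-- The maximally entangled state `Φ⁺ = (e₀⊗e₀ + e₁⊗e₁)/√2`, as a vector indexed by
`Fin 2 × Fin 2`. -/
noncomputable def phiPlus : Fin 2 × Fin 2 → ℂ :=
  fun p => if p.1 = p.2 then (1 / (Real.sqrt 2 : ℂ)) else 0

/-- The Bell vectors `Φ_b = (U_b ⊗ I)·Φ⁺` for `b ∈ {1,2,3,4}`. -/
noncomputable def bell (b : Fin 4) : Fin 2 × Fin 2 → ℂ :=
  fun p => ∑ c : Fin 2, pauliU b p.1 c * phiPlus (c, p.2)

/-- The linear map `UNOT ⊗ id` acting entrywise on matrices indexed by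
`Fin 2 × Fin 2`: `N(M)_{(a,b'),(c,d)} = (2/3)·δ_{a,c}·Σ_e M_{(e,b'),(e,d)}
− (1/3)·M_{(a,b'),(c,d)}`. -/
noncomputable def unotTensorId (M : Matrix (Fin 2 × Fin 2) (Fin 2 × Fin 2) ℂ) :
    Matrix (Fin 2 × Fin 2) (Fin 2 × Fin 2) ℂ :=
  Matrix.of fun p q =>
    (2 / 3 : ℂ) * (if p.1 = q.1 then 1 else 0) * (∑ e : Fin 2, M (e, p.2) (e, q.2))
      - (1 / 3 : ℂ) * M p q

lemma bell_apply (b : Fin 4) (p : Fin 2 × Fin 2) :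
    bell b p = pauliU b p.1 p.2 * (1 / (Real.sqrt 2 : ℂ)) := by
  simp [bell, phiPlus]

lemma one_div_sqrt_two_mul_self :
    (1 / (Real.sqrt 2 : ℂ)) * (1 / (Real.sqrt 2 : ℂ)) = 1 / 2 := by
  rw [div_mul_div_comm, ← Complex.ofReal_mul, Real.mul_self_sqrt zero_le_two]
  norm_num

lemma bell_mul_conj_bell (b y : Fin 4) (p q : Fin 2 × Fin 2) :
    bell b p * (starRingEnd ℂ) (bell y q) =
      1 / 2 * (pauliU b p.1 p.2 * (starRingEnd ℂ) (pauliU y q.1 q.2)) := by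
  rw [bell_apply, bell_apply, map_mul, map_div₀, map_one, Complex.conj_ofReal,
    mul_mul_mul_comm, one_div_sqrt_two_mul_self, mul_comm]

/-- The Bell vectors are orthonormal. -/
lemma sum_bell_mul_conj_bell (b y : Fin 4) :
    ∑ p, bell b p * (starRingEnd ℂ) (bell y p) = if y = b then 1 else 0 := by
  simp only [bell_mul_conj_bell, Fintype.sum_prod_type, Fin.sum_univ_two]
  fin_cases b <;> fin_cases y <;> norm_num [pauliU, pauliX, pauliY, pauliZ]

/-- The partial trace of a Bell state over the first factor is maximally mixed. -/
lemma partialTrace_bell (b : Fin 4) (c d : Fin 2) :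
    ∑ e, bell b (e, c) * (starRingEnd ℂ) (bell b (e, d)) = if c = d then 1 / 2 else 0 := by
  simp only [bell_mul_conj_bell, Fin.sum_univ_two]
  fin_cases b <;> fin_cases c <;> fin_cases d <;> norm_num [pauliU, pauliX, pauliY, pauliZ]

lemma unotTensorId_bell (b : Fin 4) (p q : Fin 2 × Fin 2) :
    unotTensorId (Matrix.of fun p' q' => bell b p' * (starRingEnd ℂ) (bell b q')) p q =
      1 / 3 * (if p = q then 1 else 0) - 1 / 3 * (bell b p * (starRingEnd ℂ) (bell b q)) := by
  simp only [unotTensorId, Matrix.of_apply, partialTrace_bell, Prod.ext_iff]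
  by_cases h₁ : p.1 = q.1 <;> by_cases h₂ : p.2 = q.2 <;> norm_num [h₁, h₂]

/-- In the UNOT dense-coding protocol, the probability of Bell
outcome `y` when the bomb is in `b` is `⟨Φ_y, (UNOT⊗id)(Φ_b Φ_b^*)·Φ_y⟩ =
(1 − δ_{y,b})/3`: Bob never obtains `y = b`, and obtains each `y ≠ b` with
probability `1/3`. -/
theorem unot_dense_coding (b y : Fin 4) :
    ∑ p : Fin 2 × Fin 2, ∑ q : Fin 2 × Fin 2,
      (starRingEnd ℂ) (bell y p) *
        unotTensorId (Matrix.of fun p' q' => bell b p' * (starRingEnd ℂ) (bell b q')) p q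
        * bell y q
      = if y = b then 0 else 1 / 3 := by
  have expand (p q : Fin 2 × Fin 2) :
      (starRingEnd ℂ) (bell y p) *
        unotTensorId (Matrix.of fun p' q' => bell b p' * (starRingEnd ℂ) (bell b q')) p q
        * bell y q =
      1 / 3 * (if p = q then bell y q * (starRingEnd ℂ) (bell y p) else 0) -
        1 / 3 * ((bell b p * (starRingEnd ℂ) (bell y p)) *
          (bell y q * (starRingEnd ℂ) (bell b q))) := by
    rw [unotTensorId_bell]
    split_ifs <;> ring
  simp only [expand, Finset.sum_sub_distrib, ← Finset.mul_sum, ← Finset.sum_mul,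
    Finset.sum_ite_eq, Finset.mem_univ, if_true, sum_bell_mul_conj_bell]
  by_cases h : y = b <;> simp [h]
end

section
/- Let σ₁ = X, σ₂ = Y, σ₃ = Z be the Pauli matrices. For every 2×2 complex matrix ρ: (1/3)·Σ_{i=1}^{3} Σ_{m∈{0,1}} Tr[ ((I + (−1)^m·σ_i)/2)·ρ ] · ((I − (−1)^m·σ_i)/2) = (2/3)·Tr[ρ]·I − (1/3)·ρ. That is, measuring in a uniformly random Pauli eigenbasis and re-preparing the orthogonal basis state simulates the universal NOT channel UNOT(ρ) = (2/3)·Tr[ρ]·I − (1/3)·ρ; hence UNOT can be simulated by one noiseless classical bit assisted by two perfectly correlated uniformly random trits. -/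
/-- The Pauli matrices `σ₁ = X`, `σ₂ = Y`, `σ₃ = Z`. -/
noncomputable def pauli : Fin 3 → Matrix (Fin 2) (Fin 2) ℂ :=
  ![!![0, 1; 1, 0], !![0, -Complex.I; Complex.I, 0], !![1, 0; 0, -1]]

/-- Measuring a qubit in a uniformly random Pauli eigenbasis and
re-preparing the orthogonal basis state simulates the universal NOT channel:
`(1/3)·Σ_{i=1}^{3} Σ_{m∈{0,1}} Tr[((I + (−1)^m σ_i)/2)·ρ] · ((I − (−1)^m σ_i)/2)
  = (2/3)·Tr[ρ]·I − (1/3)·ρ` for every 2×2 complex matrix `ρ`. Hence UNOT can be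
simulated by one noiseless classical bit assisted by two perfectly correlated
uniformly random trits. -/
theorem unot_measure_and_reprepare (ρ : Matrix (Fin 2) (Fin 2) ℂ) :
    (1 / 3 : ℂ) • ∑ i : Fin 3, ∑ m : Fin 2,
      (Matrix.trace (((2 : ℂ)⁻¹ • ((1 : Matrix (Fin 2) (Fin 2) ℂ)
          + ((-1 : ℂ) ^ (m : ℕ)) • pauli i)) * ρ)) •
        ((2 : ℂ)⁻¹ • ((1 : Matrix (Fin 2) (Fin 2) ℂ)
          - ((-1 : ℂ) ^ (m : ℕ)) • pauli i))
      = (2 / 3 : ℂ) • (Matrix.trace ρ) • (1 : Matrix (Fin 2) (Fin 2) ℂ)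
        - (1 / 3 : ℂ) • ρ := by
  ext a b
  fin_cases a <;> fin_cases b <;>
    simp [pauli, Fin.sum_univ_succ, Matrix.trace, Matrix.mul_apply, Matrix.one_apply] <;>
    ring_nf <;> simp only [Complex.I_sq] <;> ring
end
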